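/- arXiv:0908.1691 — 2 statements merged into one kernel-verified Lean document; each statement's English description precedes it below -/
import Mathlib

section
/- If Uⱼ ≠ 0 for at least one j ∈ {0,…,n}, then there exist a real k ≠ 0 and a complex eigenvalue λ of M(k) with Re λ > 0. (Instability of the linearised fluid-loaded plate system under any nonzero mean flow.) -/
/-- hyperbolic cotangent, `coth x = cosh x / sinh x` (for `x ≠ 0`). -/
noncomputable def coth (x : ℝ) : ℝ := Real.cosh x / Real.sinh x

/-- hyperbolic cosecant, `csch x = 1 / sinh x` (for `x ≠ 0`). -/
noncomputable def csch (x : ℝ) : ℝ := 1 / Real.sinh x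

/-- The symmetric tridiagonal matrix `A(k)` of the linearised fluid-loaded plate problem.
Rows/columns are indexed by `i : Fin n`, corresponding to the 1-based index `i+1`; the plate
separations are `Δh 0, …, Δh n`.  The 1-based entries are
`A(k)_{ii} = (k + coth(kΔh_{i−1}) + coth(kΔhᵢ))/k` and
`A(k)_{i,i+1} = A(k)_{i+1,i} = −csch(kΔhᵢ)/k`. -/
noncomputable def Amat (n : ℕ) (Δh : ℕ → ℝ) (k : ℝ) : Matrix (Fin n) (Fin n) ℝ :=
  fun i j =>
    if (i : ℕ) = (j : ℕ) then (k + coth (k * Δh (i : ℕ)) + coth (k * Δh ((i : ℕ) + 1))) / k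
    else if (i : ℕ) + 1 = (j : ℕ) then -(csch (k * Δh ((i : ℕ) + 1)) / k)
    else if (j : ℕ) + 1 = (i : ℕ) then -(csch (k * Δh ((j : ℕ) + 1)) / k)
    else 0

/-- The symmetric tridiagonal matrix `B(k)`, with 1-based entries
`B(k)_{ii} = U_{i−1}² coth(kΔh_{i−1}) + Uᵢ² coth(kΔhᵢ)` and
`B(k)_{i,i+1} = B(k)_{i+1,i} = −Uᵢ² csch(kΔhᵢ)`. -/
noncomputable def Bmat (n : ℕ) (Δh U : ℕ → ℝ) (k : ℝ) : Matrix (Fin n) (Fin n) ℝ :=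
  fun i j =>
    if (i : ℕ) = (j : ℕ) then
      U (i : ℕ) ^ 2 * coth (k * Δh (i : ℕ)) + U ((i : ℕ) + 1) ^ 2 * coth (k * Δh ((i : ℕ) + 1))
    else if (i : ℕ) + 1 = (j : ℕ) then -(U ((i : ℕ) + 1) ^ 2 * csch (k * Δh ((i : ℕ) + 1)))
    else if (j : ℕ) + 1 = (i : ℕ) then -(U ((j : ℕ) + 1) ^ 2 * csch (k * Δh ((j : ℕ) + 1)))
    else 0

/-- The symmetric tridiagonal matrix `C(k)`, with 1-based entries
`C(k)_{ii} = U_{i−1} coth(kΔh_{i−1}) + Uᵢ coth(kΔhᵢ)` and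
`C(k)_{i,i+1} = C(k)_{i+1,i} = −Uᵢ csch(kΔhᵢ)`. -/
noncomputable def Cmat (n : ℕ) (Δh U : ℕ → ℝ) (k : ℝ) : Matrix (Fin n) (Fin n) ℝ :=
  fun i j =>
    if (i : ℕ) = (j : ℕ) then
      U (i : ℕ) * coth (k * Δh (i : ℕ)) + U ((i : ℕ) + 1) * coth (k * Δh ((i : ℕ) + 1))
    else if (i : ℕ) + 1 = (j : ℕ) then -(U ((i : ℕ) + 1) * csch (k * Δh ((i : ℕ) + 1)))
    else if (j : ℕ) + 1 = (i : ℕ) then -(U ((j : ℕ) + 1) * csch (k * Δh ((j : ℕ) + 1)))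
    else 0

/-- The complex `2n × 2n` block matrix
`M(k) = [[0, Iₙ], [A(k)⁻¹(k B(k) − k⁴ Iₙ), −2i A(k)⁻¹ C(k)]]`,
real matrices being regarded as complex. -/
noncomputable def Mmat (n : ℕ) (Δh U : ℕ → ℝ) (k : ℝ) :
    Matrix (Fin n ⊕ Fin n) (Fin n ⊕ Fin n) ℂ :=
  Matrix.fromBlocks 0 1
    (((Amat n Δh k)⁻¹ *
        (k • Bmat n Δh U k - k ^ 4 • (1 : Matrix (Fin n) (Fin n) ℝ))).map
      (fun x : ℝ => (x : ℂ)))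
    ((-2 * Complex.I) • ((Amat n Δh k)⁻¹ * Cmat n Δh U k).map (fun x : ℝ => (x : ℂ)))

/-- The symmetric tridiagonal matrix with diagonal entries `a i + a (i + 1)` and off-diagonal
entries `-b (i + 1)`. -/
def tridiag {R : Type*} [CommRing R] (n : ℕ) (a b : ℕ → R) : Matrix (Fin n) (Fin n) R :=
  fun i j =>
    if (i : ℕ) = (j : ℕ) then a (i : ℕ) + a ((i : ℕ) + 1)
    else if (i : ℕ) + 1 = (j : ℕ) then -b ((i : ℕ) + 1)
    else if (j : ℕ) + 1 = (i : ℕ) then -b ((j : ℕ) + 1)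
    else 0

/-- A tridiagonal matrix of conductances acts as a difference of consecutive fluxes. -/
lemma tridiag_mulVec {R : Type*} [CommRing R] (n : ℕ) (w X : ℕ → R) (h0 : X 0 = 0)
    (hn : X (n + 1) = 0) (i : Fin n) :
    (tridiag n w w).mulVec (fun j : Fin n => X (j + 1)) i =
      w i * (X (i + 1) - X i) - w (i + 1) * (X (i + 2) - X (i + 1)) := by
  obtain ⟨i, hi⟩ := i
  have hsplit : ∀ j : ℕ,
      (if i = j then w i + w (i + 1) else if i + 1 = j then -w (i + 1)
        else if j + 1 = i then -w (j + 1) else 0) * X (j + 1) =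
      (if i = j then (w i + w (i + 1)) * X (i + 1) else 0) +
      (if i + 1 = j then -w (i + 1) * X (i + 2) else 0) +
      (if i = j + 1 then -w i * X i else 0) := by
    intro j
    by_cases h1 : i = j
    · subst h1; simp
    by_cases h2 : i + 1 = j
    · subst h2; simp [show ¬ i = i + 1 + 1 by omega]
    by_cases h3 : j + 1 = i
    · subst h3; simp [show ¬ j + 1 + 1 = j by omega]
    · simp [h1, h2, h3, show ¬ i = j + 1 by omega]
  have hsum := Fin.sum_univ_eq_sum_range (fun j : ℕ =>
      (if i = j then w i + w (i + 1) else if i + 1 = j then -w (i + 1)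
        else if j + 1 = i then -w (j + 1) else 0) * X (j + 1)) n
  have hm : (tridiag n w w).mulVec (fun j : Fin n => X (j + 1)) ⟨i, hi⟩ =
      ∑ j ∈ Finset.range n, (if i = j then w i + w (i + 1) else if i + 1 = j then -w (i + 1)
        else if j + 1 = i then -w (j + 1) else 0) * X (j + 1) := by
    rw [← hsum]; rfl
  have e2 : ∑ j ∈ Finset.range n, (if i + 1 = j then -w (i + 1) * X (i + 2) else 0) =
      -w (i + 1) * X (i + 2) := by
    rw [Finset.sum_ite_eq]
    split_ifs with h
    · rfl
    · have : i + 1 = n := by simp at h; omega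
      rw [show i + 2 = n + 1 by omega, hn, mul_zero]
  have e3 : ∑ j ∈ Finset.range n, (if i = j + 1 then -w i * X i else 0) = -w i * X i := by
    cases i with
    | zero => simp [h0]
    | succ m =>
      simp only [Nat.add_right_cancel_iff]
      rw [Finset.sum_ite_eq, if_pos (by simp; omega)]
  rw [hm, Finset.sum_congr rfl fun j _ => hsplit j, Finset.sum_add_distrib, Finset.sum_add_distrib,
    e2, e3, Finset.sum_ite_eq, if_pos (by simpa using hi)]
  simp only
  ring

/-- Every vector is the restriction of a sequence vanishing at the two boundary indices. -/
lemma exists_extension {R : Type*} [Zero R] {n : ℕ} (v : Fin n → R) :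
    ∃ X : ℕ → R, X 0 = 0 ∧ X (n + 1) = 0 ∧ v = fun j : Fin n => X (j + 1) := by
  refine ⟨fun m => if h : 0 < m ∧ m - 1 < n then v ⟨m - 1, h.2⟩ else 0, by simp, by simp, ?_⟩
  ext j
  simp

lemma tridiag_isSymm {R : Type*} [CommRing R] (n : ℕ) (a b : ℕ → R) :
    (tridiag n a b).transpose = tridiag n a b := by
  ext i j
  simp only [Matrix.transpose_apply, tridiag]
  by_cases h1 : (i : ℕ) = j
  · simp [h1]
  by_cases h2 : (i : ℕ) + 1 = j
  · simp [h1, h2, show ¬ (j : ℕ) = i by omega, show ¬ (j : ℕ) + 1 = i by omega]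
  by_cases h3 : (j : ℕ) + 1 = i
  · simp [h1, h2, h3, show ¬ (j : ℕ) = i by omega]
  · simp [h1, h2, h3, show ¬ (j : ℕ) = i by omega]

/-- Summation by parts for the Dirichlet form of a sequence of conductances. -/
lemma sum_mul_flux_diff {R : Type*} [CommRing R] (w X : ℕ → R) (h0 : X 0 = 0) (m : ℕ) :
    ∑ i ∈ Finset.range m,
        X (i + 1) * (w i * (X (i + 1) - X i) - w (i + 1) * (X (i + 2) - X (i + 1))) =
      ∑ i ∈ Finset.range m, w i * (X (i + 1) - X i) ^ 2 - X m * (w m * (X (m + 1) - X m)) := by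
  induction m with
  | zero => simp [h0]
  | succ m ih => rw [Finset.sum_range_succ, Finset.sum_range_succ, ih]; ring

lemma tridiag_posDef (n : ℕ) (w : ℕ → ℝ) (hw : ∀ i ≤ n, 0 < w i) :
    (tridiag n w w).PosDef := by
  refine Matrix.PosDef.of_dotProduct_mulVec_pos ?_ ?_
  · rw [Matrix.IsHermitian, Matrix.conjTranspose_eq_transpose_of_trivial, tridiag_isSymm]
  · intro v hv
    obtain ⟨X, h0, hn, rfl⟩ := exists_extension v
    have hq : star (fun j : Fin n => X (j + 1)) ⬝ᵥ
        (tridiag n w w).mulVec (fun j : Fin n => X (j + 1)) =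
        ∑ i ∈ Finset.range (n + 1), w i * (X (i + 1) - X i) ^ 2 := by
      rw [Finset.sum_range_succ]
      have := sum_mul_flux_diff w X h0 n
      rw [← Fin.sum_univ_eq_sum_range] at this
      simp only [dotProduct, Pi.star_apply, star_trivial, tridiag_mulVec n w X h0 hn]
      rw [this, hn]
      ring
    rw [hq]
    have hnn : ∀ i ∈ Finset.range (n + 1), 0 ≤ w i * (X (i + 1) - X i) ^ 2 := fun i hi =>
      mul_nonneg (hw i (by simp at hi; omega)).le (sq_nonneg _)
    refine lt_of_le_of_ne (Finset.sum_nonneg hnn) fun hz => hv ?_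
    have hall := (Finset.sum_eq_zero_iff_of_nonneg hnn).1 hz.symm
    have hX : ∀ m ≤ n + 1, X m = 0 := by
      intro m
      induction m with
      | zero => exact fun _ => h0
      | succ m ih =>
        intro hm
        have := hall m (by simp; omega)
        rw [ih (by omega), sub_zero] at this
        have hwm := hw m (by omega)
        simpa [hwm.ne'] using this
    ext j
    exact hX _ (by omega)

/-- Evaluating the characteristic polynomial of the block companion matrix gives the determinant of
the quadratic pencil. -/
lemma eval_charpoly_companion {n : ℕ} (A B C : Matrix (Fin n) (Fin n) ℂ) (hA : IsUnit A.det)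
    (z : ℂ) (hz : z ≠ 0) :
    A.det * (Matrix.fromBlocks 0 1 (A⁻¹ * B) (A⁻¹ * C)).charpoly.eval z =
      (z ^ 2 • A - z • C - B).det := by
  have hs : Matrix.scalar (Fin n ⊕ Fin n) z - Matrix.fromBlocks 0 1 (A⁻¹ * B) (A⁻¹ * C) =
      Matrix.fromBlocks (z • (1 : Matrix (Fin n) (Fin n) ℂ)) (-1) (-(A⁻¹ * B))
        (z • (1 : Matrix (Fin n) (Fin n) ℂ) - A⁻¹ * C) := by
    rw [Matrix.scalar_apply, ← Matrix.smul_one_eq_diagonal, ← Matrix.fromBlocks_one,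
      Matrix.fromBlocks_smul, sub_eq_add_neg, Matrix.fromBlocks_neg, Matrix.fromBlocks_add]
    simp [sub_eq_add_neg]
  have hi : (z • (1 : Matrix (Fin n) (Fin n) ℂ)) * (z⁻¹ • 1) = 1 := by
    simp [smul_smul, hz]
  have hi' : (z⁻¹ • (1 : Matrix (Fin n) (Fin n) ℂ)) * (z • 1) = 1 := by
    simp [smul_smul, hz]
  let : Invertible (z • (1 : Matrix (Fin n) (Fin n) ℂ)) := ⟨z⁻¹ • 1, hi', hi⟩
  have hinv : ⅟(z • (1 : Matrix (Fin n) (Fin n) ℂ)) = z⁻¹ • 1 := rfl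
  rw [Matrix.eval_charpoly, hs, Matrix.det_fromBlocks₁₁, hinv, ← Matrix.det_mul, ← Matrix.det_mul]
  congr 1
  rw [Matrix.smul_mul, Matrix.one_mul, Matrix.mul_smul, mul_sub, mul_sub]
  simp [smul_sub, smul_smul, hz, Matrix.mul_nonsing_inv_cancel_left _ _ hA, pow_two]

/-- A monic complex polynomial without roots in the right half-plane is bounded below there. -/
lemma re_pow_natDegree_le_norm_eval {p : Polynomial ℂ} (hp : p.Monic)
    (h : ∀ r ∈ p.roots, r.re ≤ 0) {z : ℂ} (hz : 0 ≤ z.re) :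
    z.re ^ p.natDegree ≤ ‖p.eval z‖ := by
  have hsp := IsAlgClosed.splits p
  rw [hsp.eval_eq_prod_roots_of_monic hp, hsp.natDegree_eq_card_roots]
  generalize p.roots = s at h
  induction s using Multiset.induction with
  | empty => simp
  | cons a s ih =>
    rw [Multiset.card_cons, Multiset.map_cons, Multiset.prod_cons, norm_mul, pow_succ']
    refine mul_le_mul ?_ (ih fun r hr => h r (Multiset.mem_cons_of_mem hr)) (by positivity)
      (norm_nonneg _)
    have h1 := h a (Multiset.mem_cons_self a s)
    calc z.re ≤ (z - a).re := by simp; linarith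
      _ ≤ ‖z - a‖ := Complex.re_le_norm _

open Polynomial in
/-- A rational function `∑ H v / (z + v) ^ 2` with positive weights and at least two real poles has
a zero in the lower half-plane. -/
lemma exists_sum_div_sq_eq_zero (V : Finset ℝ) (H : ℝ → ℝ) (hH : ∀ v ∈ V, 0 < H v)
    (hV : 2 ≤ V.card) :
    ∃ z : ℂ, z.im < 0 ∧ ∑ v ∈ V, (H v : ℂ) / (z + v) ^ 2 = 0 := by
  have hVne : V.Nonempty := Finset.card_pos.1 (by omega)
  have hmon : ∀ v : ℝ, ((X + C v : ℝ[X]) ^ 2).Monic := fun v => (monic_X_add_C v).pow 2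
  set q : ℝ[X] := ∑ v ∈ V, C (H v) * ∏ u ∈ V.erase v, (X + C u) ^ 2 with hq
  set d := 2 * (V.card - 1)
  have hcoeff : q.coeff d = ∑ v ∈ V, H v := by
    rw [hq, finsetSum_coeff]
    refine Finset.sum_congr rfl fun v hv => ?_
    have hm := monic_prod_of_monic (V.erase v) (fun u => (X + C u : ℝ[X]) ^ 2) fun u _ => hmon u
    have hd : (∏ u ∈ V.erase v, (X + C u : ℝ[X]) ^ 2).natDegree = d := by
      rw [natDegree_prod_of_monic _ _ fun u _ => hmon u]
      simp [natDegree_pow, Finset.card_erase_of_mem hv, d, mul_comm]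
    rw [coeff_C_mul, ← hd, hm.coeff_natDegree, mul_one]
  have hcne : q.coeff d ≠ 0 := by rw [hcoeff]; exact (Finset.sum_pos hH hVne).ne'
  have hdeg : (q.map (algebraMap ℝ ℂ)).degree ≠ 0 := by
    rw [degree_map]
    have := le_degree_of_ne_zero hcne
    intro h0
    rw [h0] at this
    have : d ≤ 0 := by exact_mod_cast this
    omega
  obtain ⟨z, hz⟩ := IsAlgClosed.exists_root _ hdeg
  have heval : ∑ v ∈ V, (H v : ℂ) * ∏ u ∈ V.erase v, (z + u) ^ 2 = 0 := by
    have : (q.map (algebraMap ℝ ℂ)).eval z = 0 := hz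
    rw [hq, Polynomial.map_sum, eval_finsetSum] at this
    simpa [Polynomial.map_prod, eval_prod] using this
  have him : z.im ≠ 0 := by
    intro him
    obtain ⟨x, rfl⟩ : ∃ x : ℝ, z = x := ⟨z.re, by apply Complex.ext <;> simp [him]⟩
    have hr : ∑ v ∈ V, H v * ∏ u ∈ V.erase v, (x + u) ^ 2 = 0 := by exact_mod_cast heval
    have hnn : ∀ v ∈ V, 0 ≤ H v * ∏ u ∈ V.erase v, (x + u) ^ 2 := fun v hv =>
      mul_nonneg (hH v hv).le (Finset.prod_nonneg fun u _ => sq_nonneg _)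
    have hall := (Finset.sum_eq_zero_iff_of_nonneg hnn).1 hr
    have hprod : ∀ v ∈ V, ∃ u ∈ V.erase v, x + u = 0 := by
      intro v hv
      have := (mul_eq_zero.1 (hall v hv)).resolve_left (hH v hv).ne'
      obtain ⟨u, hu, h⟩ := Finset.prod_eq_zero_iff.1 this
      exact ⟨u, hu, by simpa using h⟩
    obtain ⟨v, hv⟩ := hVne
    obtain ⟨u, hu, hxu⟩ := hprod v hv
    obtain ⟨u', hu', hxu'⟩ := hprod u (Finset.mem_of_mem_erase hu)
    exact Finset.ne_of_mem_erase hu' (by linarith)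
  have hsum : ∑ v ∈ V, (H v : ℂ) / (z + v) ^ 2 = 0 := by
    have hne : ∀ v : ℝ, (z + v) ^ 2 ≠ 0 := fun v h => by
      have := congrArg Complex.im (pow_eq_zero_iff (two_ne_zero) |>.1 h)
      exact him (by simpa using this)
    have hP : ∏ u ∈ V, (z + (u : ℂ)) ^ 2 ≠ 0 := Finset.prod_ne_zero_iff.2 fun u _ => hne u
    apply (mul_eq_zero.1 (?_ : (∏ u ∈ V, (z + (u : ℂ)) ^ 2) * _ = 0)).resolve_left hP
    rw [Finset.mul_sum, ← heval]
    refine Finset.sum_congr rfl fun v hv => ?_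
    rw [← Finset.mul_prod_erase V _ hv]
    have hv' : z + (v : ℂ) ≠ 0 := fun h => hne v (by rw [h]; ring)
    field_simp
  rcases lt_or_gt_of_ne him with h | h
  · exact ⟨z, h, hsum⟩
  · refine ⟨starRingEnd ℂ z, by simpa using h, ?_⟩
    have := congrArg (starRingEnd ℂ) hsum
    simpa using this

lemma tendsto_sinh_mul_div (h : ℝ) :
    Filter.Tendsto (fun k : ℝ => Real.sinh (k * h) / k) (nhdsWithin 0 (Set.Ioi 0)) (nhds h) := by
  have hd : HasDerivAt (fun k : ℝ => Real.sinh (k * h)) h 0 := by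
    simpa using ((hasDerivAt_id (0 : ℝ)).mul_const h).sinh
  have := hd.tendsto_slope_zero_right
  simpa [div_eq_inv_mul] using this

lemma tendsto_mul_csch {h : ℝ} (hh : 0 < h) :
    Filter.Tendsto (fun k : ℝ => k * csch (k * h)) (nhdsWithin 0 (Set.Ioi 0)) (nhds h⁻¹) := by
  refine ((tendsto_sinh_mul_div h).inv₀ hh.ne').congr fun k => ?_
  rw [csch, inv_div]
  ring

lemma tendsto_mul_coth {h : ℝ} (hh : 0 < h) :
    Filter.Tendsto (fun k : ℝ => k * coth (k * h)) (nhdsWithin 0 (Set.Ioi 0)) (nhds h⁻¹) := by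
  have hc : Filter.Tendsto (fun k : ℝ => Real.cosh (k * h)) (nhdsWithin 0 (Set.Ioi 0))
      (nhds 1) := by
    have : Continuous fun k : ℝ => Real.cosh (k * h) := by fun_prop
    simpa using (this.tendsto 0).mono_left nhdsWithin_le_nhds
  have := hc.mul (tendsto_mul_csch hh)
  rw [one_mul] at this
  refine this.congr fun k => ?_
  rw [csch, coth]
  ring

/-- The rescaled quadratic pencil at wavenumber `k`, with `ν` the coefficient of the identity and
`β i` the weight of the `i`-th fluid layer. -/
noncomputable def scaledPencil (n : ℕ) (Δh : ℕ → ℝ) (k : ℝ) (ν : ℂ) (β : ℕ → ℂ) :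
    Matrix (Fin n) (Fin n) ℂ :=
  ν • (1 : Matrix (Fin n) (Fin n) ℂ) +
    tridiag n (fun i => β i * ((k * coth (k * Δh i) : ℝ) : ℂ))
      (fun i => β i * ((k * csch (k * Δh i) : ℝ) : ℂ))

lemma tendsto_det_scaledPencil {n : ℕ} {Δh : ℕ → ℝ} (hΔh : ∀ i ≤ n, 0 < Δh i)
    {ν : ℝ → ℂ} {ν₀ : ℂ} {β : ℕ → ℂ}
    (hν : Filter.Tendsto ν (nhdsWithin 0 (Set.Ioi 0)) (nhds ν₀)) :
    Filter.Tendsto (fun k => (scaledPencil n Δh k (ν k) β).det) (nhdsWithin 0 (Set.Ioi 0))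
      (nhds (ν₀ • (1 : Matrix (Fin n) (Fin n) ℂ) +
        tridiag n (fun i => β i * ((Δh i)⁻¹ : ℂ)) (fun i => β i * ((Δh i)⁻¹ : ℂ))).det) := by
  have hcoth : ∀ i ≤ n, Filter.Tendsto (fun k : ℝ => β i * ((k * coth (k * Δh i) : ℝ) : ℂ))
      (nhdsWithin 0 (Set.Ioi 0)) (nhds (β i * ((Δh i)⁻¹ : ℂ))) := fun i hi => by
    have := (Complex.continuous_ofReal.tendsto _).comp (tendsto_mul_coth (hΔh i hi))
    simpa using this.const_mul (β i)
  have hcsch : ∀ i ≤ n, Filter.Tendsto (fun k : ℝ => β i * ((k * csch (k * Δh i) : ℝ) : ℂ))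
      (nhdsWithin 0 (Set.Ioi 0)) (nhds (β i * ((Δh i)⁻¹ : ℂ))) := fun i hi => by
    have := (Complex.continuous_ofReal.tendsto _).comp (tendsto_mul_csch (hΔh i hi))
    simpa using this.const_mul (β i)
  refine ((continuous_id.matrix_det).tendsto _).comp ?_
  refine (hν.smul_const _).add ?_
  refine tendsto_pi_nhds.2 fun i => tendsto_pi_nhds.2 fun j => ?_
  simp only [tridiag]
  split_ifs with h1 h2 h3
  · exact (hcoth _ (by omega)).add (hcoth _ (by omega))
  · exact (hcsch _ (by omega)).neg
  · exact (hcsch _ (by omega)).neg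
  · exact tendsto_const_nhds

lemma smul_Amat_map {n : ℕ} (Δh : ℕ → ℝ) {k : ℝ} (hk : k ≠ 0) :
    ((k : ℂ) ^ 2) • (Amat n Δh k).map (fun x : ℝ => (x : ℂ)) =
      scaledPencil n Δh k ((k : ℂ) ^ 2) (fun _ => 1) := by
  have hk' : (k : ℂ) ≠ 0 := by exact_mod_cast hk
  ext i j
  simp only [Amat, scaledPencil, tridiag, Matrix.smul_apply, Matrix.map_apply, Matrix.add_apply,
    Matrix.one_apply, Fin.ext_iff]
  split_ifs <;> simp <;> field_simp
  ring

lemma pencil_eq_smul_scaledPencil {n : ℕ} (Δh U : ℕ → ℝ) {k : ℝ} (hk : k ≠ 0) {c μ ν : ℂ}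
    {β : ℕ → ℂ} (hν : c ^ 2 * ν = k ^ 2 * μ ^ 2 + k ^ 4)
    (hβ : ∀ i ≤ n, c ^ 2 * β i = (μ + Complex.I * U i) ^ 2) :
    ((k * μ) ^ 2) • (Amat n Δh k).map (fun x : ℝ => (x : ℂ)) -
      (k * μ) • ((-2 * Complex.I) • (Cmat n Δh U k).map (fun x : ℝ => (x : ℂ))) -
      (k • Bmat n Δh U k - k ^ 4 • (1 : Matrix (Fin n) (Fin n) ℝ)).map (fun x : ℝ => (x : ℂ)) =
    c ^ 2 • scaledPencil n Δh k ν β := by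
  have hkk : (k : ℂ) * (k : ℂ)⁻¹ = 1 := mul_inv_cancel₀ (by exact_mod_cast hk)
  ext i j
  have hi := hβ i (by omega)
  have hi1 := hβ (i + 1) (by omega)
  have hj1 := hβ (j + 1) (by omega)
  simp only [Amat, Bmat, Cmat, scaledPencil, tridiag, Matrix.smul_apply, Matrix.map_apply,
    Matrix.add_apply, Matrix.sub_apply, Matrix.one_apply, Fin.ext_iff, smul_eq_mul, mul_add]
  split_ifs with h1 h2 h3
  · push_cast
    linear_combination
      k * μ ^ 2 * (k + coth (k * Δh i) + coth (k * Δh (i + 1))) * hkk - hν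
      - k * coth (k * Δh i) * hi - k * coth (k * Δh (i + 1)) * hi1
      - (k * coth (k * Δh i) * U i ^ 2 + k * coth (k * Δh (i + 1)) * U (i + 1) ^ 2) * Complex.I_sq
  · push_cast
    linear_combination
      -(k * μ ^ 2 * csch (k * Δh (i + 1))) * hkk + k * csch (k * Δh (i + 1)) * hi1
      + k * csch (k * Δh (i + 1)) * U (i + 1) ^ 2 * Complex.I_sq
  · push_cast
    linear_combination
      -(k * μ ^ 2 * csch (k * Δh (j + 1))) * hkk + k * csch (k * Δh (j + 1)) * hj1
      + k * csch (k * Δh (j + 1)) * U (j + 1) ^ 2 * Complex.I_sq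
  · simp

/-- If `M(k)` has no eigenvalue in the open right half-plane then the determinant of the quadratic
pencil is bounded below there. -/
lemma norm_det_pencil_ge {n : ℕ} {Δh U : ℕ → ℝ} {k : ℝ}
    (hst : ∀ r ∈ (Mmat n Δh U k).charpoly.roots, r.re ≤ 0) {z : ℂ} (hz : 0 < z.re) :
    ‖((Amat n Δh k).map (fun x : ℝ => (x : ℂ))).det‖ * z.re ^ (2 * n) ≤
      ‖(z ^ 2 • (Amat n Δh k).map (fun x : ℝ => (x : ℂ)) -
      z • ((-2 * Complex.I) • (Cmat n Δh U k).map (fun x : ℝ => (x : ℂ))) -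
      (k • Bmat n Δh U k - k ^ 4 • (1 : Matrix (Fin n) (Fin n) ℝ)).map
        (fun x : ℝ => (x : ℂ))).det‖ := by
  by_cases hA : ((Amat n Δh k).map (fun x : ℝ => (x : ℂ))).det = 0
  · rw [hA, norm_zero, zero_mul]; exact norm_nonneg _
  have hdet : ((Amat n Δh k).map (fun x : ℝ => (x : ℂ))).det = ((Amat n Δh k).det : ℂ) :=
    (RingHom.map_det Complex.ofRealHom (Amat n Δh k)).symm
  have hA' : IsUnit (Amat n Δh k).det := by
    rw [hdet] at hA
    exact isUnit_iff_ne_zero.2 (by exact_mod_cast hA)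
  have hmul : ∀ P Q : Matrix (Fin n) (Fin n) ℝ, (P * Q).map (fun x : ℝ => (x : ℂ)) =
      P.map (fun x : ℝ => (x : ℂ)) * Q.map (fun x : ℝ => (x : ℂ)) := fun P Q =>
    Matrix.map_mul (f := Complex.ofRealHom)
  have hinv : (Amat n Δh k)⁻¹.map (fun x : ℝ => (x : ℂ)) =
      ((Amat n Δh k).map (fun x : ℝ => (x : ℂ)))⁻¹ := by
    symm
    apply Matrix.inv_eq_right_inv
    rw [← hmul, Matrix.mul_nonsing_inv _ hA']
    exact Matrix.map_one _ Complex.ofReal_zero Complex.ofReal_one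
  have hM : Mmat n Δh U k = Matrix.fromBlocks 0 1
      (((Amat n Δh k).map (fun x : ℝ => (x : ℂ)))⁻¹ *
        (k • Bmat n Δh U k - k ^ 4 • (1 : Matrix (Fin n) (Fin n) ℝ)).map (fun x : ℝ => (x : ℂ)))
      (((Amat n Δh k).map (fun x : ℝ => (x : ℂ)))⁻¹ *
        ((-2 * Complex.I) • (Cmat n Δh U k).map (fun x : ℝ => (x : ℂ)))) := by
    rw [Mmat, hmul, hmul, hinv, Matrix.mul_smul]
  rw [← eval_charpoly_companion _ _ _ (isUnit_iff_ne_zero.2 hA) z (fun h => by simp [h] at hz),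
    ← hM, norm_mul]
  refine mul_le_mul_of_nonneg_left ?_ (norm_nonneg _)
  have := re_pow_natDegree_le_norm_eval (Matrix.charpoly_monic (Mmat n Δh U k)) hst hz.le
  rwa [Matrix.charpoly_natDegree_eq_dim, Fintype.card_sum, Fintype.card_fin, ← two_mul] at this

lemma tridiag_map_ofReal (n : ℕ) (w : ℕ → ℝ) :
    (tridiag n w w).map (fun x : ℝ => (x : ℂ)) =
      tridiag n (fun i => (w i : ℂ)) (fun i => (w i : ℂ)) := by
  ext i j
  simp only [tridiag, Matrix.map_apply]
  split_ifs <;> simp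

/-- Long-wave limit: if no `M(k)` has an eigenvalue in the open right half-plane, then the
determinant of a rescaled limit pencil cannot vanish. -/
lemma det_limit_ne_zero {n : ℕ} {Δh U : ℕ → ℝ} (hΔh : ∀ i ≤ n, 0 < Δh i)
    (hst : ∀ k : ℝ, k ≠ 0 → ∀ r ∈ (Mmat n Δh U k).charpoly.roots, r.re ≤ 0)
    {c : ℝ → ℝ} {r : ℝ} (hr : 0 < r) {μ ν : ℝ → ℂ} {ν₀ : ℂ} {β : ℕ → ℂ}
    (hν : Filter.Tendsto ν (nhdsWithin 0 (Set.Ioi 0)) (nhds ν₀))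
    (hc : ∀ k, 0 < k → 0 < c k) (hμ : ∀ k, 0 < k → (μ k).re = c k * r)
    (hcν : ∀ k : ℝ, 0 < k → (c k : ℂ) ^ 2 * ν k = k ^ 2 * μ k ^ 2 + k ^ 4)
    (hcβ : ∀ k, 0 < k → ∀ i ≤ n, (c k : ℂ) ^ 2 * β i = (μ k + Complex.I * U i) ^ 2) :
    (ν₀ • (1 : Matrix (Fin n) (Fin n) ℂ) +
        tridiag n (fun i => β i * ((Δh i)⁻¹ : ℂ)) (fun i => β i * ((Δh i)⁻¹ : ℂ))).det ≠ 0 := by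
  have hA := tendsto_det_scaledPencil hΔh (ν := fun k => (k : ℂ) ^ 2) (ν₀ := 0)
    (β := fun _ => 1) (by
      have : Continuous fun k : ℝ => (k : ℂ) ^ 2 := by fun_prop
      simpa using (this.tendsto 0).mono_left nhdsWithin_le_nhds)
  have hQ := tendsto_det_scaledPencil hΔh (β := β) hν
  have hle : (fun k : ℝ => ‖(scaledPencil n Δh k ((k : ℂ) ^ 2) (fun _ => 1)).det‖ * r ^ (2 * n))
      ≤ᶠ[nhdsWithin 0 (Set.Ioi 0)] fun k => ‖(scaledPencil n Δh k (ν k) β).det‖ := by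
    filter_upwards [self_mem_nhdsWithin] with k hk
    have hk : 0 < k := hk
    have hck := hc k hk
    have hre : ((k : ℂ) * μ k).re = k * (c k * r) := by simp [hμ k hk]
    have hge := norm_det_pencil_ge (hst k hk.ne') (z := k * μ k) (by rw [hre]; positivity)
    rw [pencil_eq_smul_scaledPencil Δh U hk.ne' (hcν k hk) (hcβ k hk), Matrix.det_smul, hre,
      norm_mul] at hge
    rw [← smul_Amat_map Δh hk.ne', Matrix.det_smul, norm_mul]
    simp only [norm_pow, Complex.norm_real, Real.norm_eq_abs, Fintype.card_fin, abs_of_pos hk,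
      abs_of_pos hck] at hge ⊢
    rw [← pow_mul] at hge ⊢
    refine le_of_mul_le_mul_left ?_ (pow_pos hck (2 * n))
    refine le_trans (le_of_eq ?_) hge
    ring
  have hlim := le_of_tendsto_of_tendsto (hA.norm.mul_const _) hQ.norm hle
  intro h0
  rw [h0, norm_zero, zero_smul, zero_add] at hlim
  have hpos : (tridiag n (fun i => (Δh i)⁻¹) (fun i => (Δh i)⁻¹)).det ≠ 0 :=
    (tridiag_posDef n _ fun i hi => inv_pos.2 (hΔh i hi)).det_pos.ne'
  have hmap := RingHom.map_det Complex.ofRealHom (tridiag n (fun i => (Δh i)⁻¹) (fun i => (Δh i)⁻¹))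
  have hmap' : Complex.ofRealHom.mapMatrix (tridiag n (fun i => (Δh i)⁻¹) (fun i => (Δh i)⁻¹)) =
      tridiag n (fun i => (((Δh i)⁻¹ : ℝ) : ℂ)) (fun i => (((Δh i)⁻¹ : ℝ) : ℂ)) :=
    tridiag_map_ofReal n _
  rw [hmap'] at hmap
  simp only [one_mul, ← Complex.ofReal_inv, ← hmap] at hlim
  have : 0 < ‖Complex.ofRealHom (tridiag n (fun i => (Δh i)⁻¹) (fun i => (Δh i)⁻¹)).det‖ :=
    norm_pos_iff.2 (by simpa using hpos)
  have := mul_pos this (pow_pos hr (2 * n))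
  linarith

/-- Conductances whose resistances sum to zero give a singular tridiagonal matrix. -/
lemma det_tridiag_eq_zero {n : ℕ} (hn : 1 ≤ n) (w : ℕ → ℂ) (hw : ∀ i ≤ n, w i ≠ 0)
    (hsum : ∑ i ∈ Finset.range (n + 1), (w i)⁻¹ = 0) : (tridiag n w w).det = 0 := by
  set X : ℕ → ℂ := fun m => ∑ i ∈ Finset.range m, (w i)⁻¹ with hX
  have hdiff : ∀ i ≤ n, w i * (X (i + 1) - X i) = 1 := fun i hi => by
    simp [hX, Finset.sum_range_succ, hw i hi]
  refine Matrix.exists_mulVec_eq_zero_iff.1 ⟨fun j => X (j + 1), fun h => ?_, ?_⟩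
  · have := congrFun h ⟨0, by omega⟩
    simp [hX, hw 0 (by omega)] at this
  · ext i
    rw [tridiag_mulVec n w X (by simp [hX]) hsum, hdiff i (by omega), hdiff (i + 1) (by omega)]
    simp

lemma exists_root_re_pos {n : ℕ} {Δh U : ℕ → ℝ} (hΔh : ∀ i ≤ n, 0 < Δh i)
    (hU : ∃ j ≤ n, U j ≠ U 0) :
    ∃ μ : ℂ, 0 < μ.re ∧
      ∑ i ∈ Finset.range (n + 1), ((μ + Complex.I * U i) ^ 2 * ((Δh i)⁻¹ : ℂ))⁻¹ = 0 := by
  obtain ⟨j, hj, hj0⟩ := hU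
  have hmem : ∀ i ≤ n, i ∈ Finset.range (n + 1) := fun i hi => by simp; omega
  obtain ⟨z, hz, hsum⟩ := exists_sum_div_sq_eq_zero ((Finset.range (n + 1)).image U)
    (fun v => ∑ i ∈ Finset.range (n + 1) with U i = v, Δh i)
    (fun v hv => by
      obtain ⟨i, hi, rfl⟩ := Finset.mem_image.1 hv
      refine Finset.sum_pos (fun m hm => hΔh m ?_) ⟨i, by simp at hi ⊢; omega⟩
      simp at hm
      omega)
    (by
      refine Finset.one_lt_card.2 ⟨U j, Finset.mem_image_of_mem _ (hmem j hj), U 0,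
        Finset.mem_image_of_mem _ (hmem 0 (by omega)), hj0⟩)
  refine ⟨Complex.I * z, by simpa using hz, ?_⟩
  have hfib : ∑ i ∈ Finset.range (n + 1), (Δh i : ℂ) / (z + U i) ^ 2 = 0 := by
    rw [← hsum, ← Finset.sum_fiberwise_of_maps_to (g := U) (t := (Finset.range (n + 1)).image U)
      fun i hi => Finset.mem_image_of_mem _ hi]
    refine Finset.sum_congr rfl fun v _ => ?_
    push_cast
    rw [Finset.sum_div]
    refine Finset.sum_congr rfl fun i hi => ?_
    rw [(Finset.mem_filter.1 hi).2]
  rw [← neg_zero, ← hfib, ← Finset.sum_neg_distrib]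
  refine Finset.sum_congr rfl fun i _ => ?_
  rw [← mul_add, mul_pow, Complex.I_sq, mul_inv, mul_inv, inv_inv]
  ring

lemma exists_det_sub_smul_eq_zero {n : ℕ} (hn : 1 ≤ n) {w : ℕ → ℝ} (hw : ∀ i ≤ n, 0 < w i) :
    ∃ t : ℝ, 0 < t ∧
      (tridiag n (fun i => (w i : ℂ)) (fun i => (w i : ℂ)) -
        (t : ℂ) • (1 : Matrix (Fin n) (Fin n) ℂ)).det = 0 := by
  have hpd := tridiag_posDef n w hw
  set i₀ : Fin n := ⟨0, by omega⟩
  refine ⟨hpd.isHermitian.eigenvalues i₀, hpd.eigenvalues_pos i₀, ?_⟩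
  have hr : (tridiag n w w - hpd.isHermitian.eigenvalues i₀ •
      (1 : Matrix (Fin n) (Fin n) ℝ)).det = 0 := by
    refine Matrix.exists_mulVec_eq_zero_iff.1 ⟨(hpd.isHermitian.eigenvectorBasis i₀).ofLp,
      fun h => ?_, ?_⟩
    · apply hpd.isHermitian.eigenvectorBasis.orthonormal.ne_zero i₀
      ext m
      exact congrFun h m
    · rw [Matrix.sub_mulVec, hpd.isHermitian.mulVec_eigenvectorBasis, Matrix.smul_mulVec,
        Matrix.one_mulVec, sub_self]
  have := congrArg Complex.ofRealHom hr
  rw [RingHom.map_det, map_zero] at this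
  rw [← this, ← tridiag_map_ofReal]
  congr 1
  ext i j
  simp [Matrix.one_apply]
  split_ifs <;> simp

/-- if some mean-flow speed `Uⱼ` (for `j ≤ n`) is nonzero, then there exist a
real `k ≠ 0` and an eigenvalue `λ` of `M(k)` with `Re λ > 0`. -/
theorem statement11 (n : ℕ) (hn : 1 ≤ n) (Δh U : ℕ → ℝ) (hΔh : ∀ i ≤ n, 0 < Δh i)
    (hU : ∃ j ≤ n, U j ≠ 0) :
    ∃ k : ℝ, k ≠ 0 ∧ ∃ lam ∈ (Mmat n Δh U k).charpoly.roots, 0 < lam.re := by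
  by_contra! hst
  by_cases hconst : ∃ j ≤ n, U j ≠ U 0
  · obtain ⟨μ, hμ, hsum⟩ := exists_root_re_pos hΔh hconst
    have hν : Filter.Tendsto (fun k : ℝ => (k : ℂ) ^ 2 * μ ^ 2 + k ^ 4)
        (nhdsWithin 0 (Set.Ioi 0)) (nhds 0) := by
      have : Continuous fun k : ℝ => (k : ℂ) ^ 2 * μ ^ 2 + k ^ 4 := by fun_prop
      simpa using (this.tendsto 0).mono_left nhdsWithin_le_nhds
    refine det_limit_ne_zero hΔh hst hμ (c := fun _ => 1) (μ := fun _ => μ)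
      (β := fun i => (μ + Complex.I * U i) ^ 2) hν (by simp) (by simp) (by simp) (by simp) ?_
    rw [zero_smul, zero_add]
    refine det_tridiag_eq_zero hn _ (fun i hi => ?_) hsum
    refine mul_ne_zero (pow_ne_zero _ fun h => ?_) (inv_ne_zero ?_)
    · have := congrArg Complex.re h
      simp at this
      exact hμ.ne' this
    · exact_mod_cast (hΔh i hi).ne'
  · push Not at hconst
    have hU0 : U 0 ≠ 0 := by
      obtain ⟨j, hj, h⟩ := hU
      rwa [hconst j hj] at h
    obtain ⟨t, ht, hdet⟩ := exists_det_sub_smul_eq_zero hn (w := fun i => (Δh i)⁻¹)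
      fun i hi => inv_pos.2 (hΔh i hi)
    obtain ⟨δ, hδ, hδt⟩ : ∃ δ : ℝ, 0 < δ ∧ δ ^ 2 * t = U 0 ^ 2 :=
      ⟨Real.sqrt (U 0 ^ 2 / t), Real.sqrt_pos.2 (by positivity), by
        rw [Real.sq_sqrt (by positivity)]; field_simp⟩
    have hν : Filter.Tendsto (fun k : ℝ => ((k : ℂ) * δ - Complex.I * U 0) ^ 2 + k ^ 2)
        (nhdsWithin 0 (Set.Ioi 0)) (nhds (-(U 0 : ℂ) ^ 2)) := by
      have : Continuous fun k : ℝ => ((k : ℂ) * δ - Complex.I * U 0) ^ 2 + k ^ 2 := by fun_prop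
      have := (this.tendsto 0).mono_left (nhdsWithin_le_nhds (s := Set.Ioi 0))
      simpa [mul_pow] using this
    refine det_limit_ne_zero hΔh hst hδ (c := fun k => k)
      (μ := fun k => (k : ℂ) * δ - Complex.I * U 0)
      (β := fun _ => (δ : ℂ) ^ 2) hν (by simp) (by simp) (fun k _ => by ring) (fun k _ i hi => ?_) ?_
    · rw [hconst i hi]
      ring
    · have hδt' : (δ : ℂ) ^ 2 * t = (U 0 : ℂ) ^ 2 := by exact_mod_cast hδt
      have : -(U 0 : ℂ) ^ 2 • (1 : Matrix (Fin n) (Fin n) ℂ) +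
          tridiag n (fun i => (δ : ℂ) ^ 2 * ((Δh i)⁻¹ : ℂ))
            (fun i => (δ : ℂ) ^ 2 * ((Δh i)⁻¹ : ℂ)) =
          (δ : ℂ) ^ 2 • (tridiag n (fun i => (((Δh i)⁻¹ : ℝ) : ℂ))
            (fun i => (((Δh i)⁻¹ : ℝ) : ℂ)) - (t : ℂ) • 1) := by
        rw [smul_sub, smul_smul, hδt', neg_smul, neg_add_eq_sub]
        congr 1
        ext i j
        simp only [tridiag, Matrix.smul_apply, smul_eq_mul]
        split_ifs <;> push_cast <;> ring
      rw [this, Matrix.det_smul, hdet, mul_zero]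
end

section
/- Suppose Uⱼ = 0 for all j ∈ {0,…,n}. Then for every real k ≠ 0: a complex number μ is an eigenvalue of M(k) if and only if there is a (real) eigenvalue λ of A(k) with λ μ² = −k⁴; in particular every eigenvalue of M(k) is purely imaginary, and M(k) has exactly 2n distinct eigenvalues (hence is diagonalisable). -/
/-- A matrix with distinct scalars `d i` and eigenvectors `v i` attached to them is diagonalised
by the matrix whose columns are the `v i`. -/
theorem Matrix.exists_diagonalization_of_eigenvectors {ι K : Type*} [Fintype ι] [DecidableEq ι]
    [Field K] (M : Matrix ι ι K) (d : ι → K) (hd : Function.Injective d) (v : ι → ι → K)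
    (hv : ∀ i, v i ≠ 0) (hM : ∀ i, M.mulVec (v i) = d i • v i) :
    ∃ P : Matrix ι ι K, IsUnit P.det ∧ M = P * Matrix.diagonal d * P⁻¹ := by
  have hli : LinearIndependent K v :=
    Module.End.eigenvectors_linearIndependent' (Matrix.toLin' M) d hd v fun i =>
      Module.End.hasEigenvector_iff.mpr
        ⟨Module.End.mem_eigenspace_iff.mpr (by simpa using hM i), hv i⟩
  have hP : IsUnit (Matrix.of v).transpose := by
    rw [← Matrix.linearIndependent_cols_iff_isUnit]
    exact hli
  have hdet : IsUnit (Matrix.of v).transpose.det := (Matrix.isUnit_iff_isUnit_det _).mp hP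
  refine ⟨(Matrix.of v).transpose, hdet, ?_⟩
  have hcomm : M * (Matrix.of v).transpose = (Matrix.of v).transpose * Matrix.diagonal d := by
    ext i j
    have h := congrFun (hM j) i
    rw [Matrix.mul_diagonal]
    simpa [Matrix.mul_apply, Matrix.mulVec, dotProduct, mul_comm] using h
  rw [← hcomm, Matrix.mul_nonsing_inv_cancel_right _ _ hdet]

/-- The roots of the characteristic polynomial of a diagonalised matrix. -/
theorem Matrix.roots_charpoly_of_diagonalization {ι K : Type*} [Fintype ι] [DecidableEq ι]
    [Field K] {M P : Matrix ι ι K} {d : ι → K} (hP : IsUnit P.det)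
    (hM : M = P * Matrix.diagonal d * P⁻¹) :
    M.charpoly.roots = Finset.univ.val.map d := by
  obtain ⟨u, hu⟩ := (Matrix.isUnit_iff_isUnit_det P).mpr hP
  have h : M.charpoly = (Matrix.diagonal d).charpoly := by
    rw [hM, ← hu, Matrix.charpoly_units_conj]
  rw [h, Matrix.charpoly_diagonal]
  have hr := Polynomial.roots_multiset_prod_X_sub_C (Finset.univ.val.map d)
  rwa [Multiset.map_map] at hr

/-- An eigenvector of a matrix that vanishes above the superdiagonal and has nonzero
superdiagonal entries is determined by its first coordinate. -/
theorem Matrix.eq_zero_of_superdiag_of_zero {K : Type*} [Field K] {n : ℕ}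
    (A : Matrix (Fin n) (Fin n) K)
    (hzero : ∀ i j : Fin n, (i : ℕ) + 1 < j → A i j = 0)
    (hne : ∀ i j : Fin n, (i : ℕ) + 1 = j → A i j ≠ 0)
    {lam : K} {v : Fin n → K} (hv : A.mulVec v = lam • v)
    (h0 : ∀ i : Fin n, (i : ℕ) = 0 → v i = 0) : v = 0 := by
  have key : ∀ m : ℕ, ∀ i : Fin n, (i : ℕ) = m → v i = 0 := by
    intro m
    induction m using Nat.strong_induction_on with
    | _ m ih =>
      intro i hi
      rcases m with _ | m
      · exact h0 i hi
      · have hm : m < n := by omega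
        have hrow := congrFun hv ⟨m, hm⟩
        have hvm : v ⟨m, hm⟩ = 0 := ih m (by omega) _ rfl
        rw [Pi.smul_apply, hvm, smul_zero, Matrix.mulVec, dotProduct,
          Finset.sum_eq_single i] at hrow
        · exact (mul_eq_zero.mp hrow).resolve_left (hne _ _ (by simp [hi]))
        · intro j _ hji
          have hji' : (j : ℕ) ≠ i := fun h => hji (Fin.ext h)
          rcases lt_or_ge (j : ℕ) (m + 1) with h | h
          · rw [ih j h j rfl, mul_zero]
          · rw [hzero _ _ (by simp; omega), zero_mul]
        · simp
  funext i
  exact key i i rfl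

/-- The eigenvalues of a real symmetric matrix that vanishes above the superdiagonal and has
nonzero superdiagonal entries are distinct. -/
theorem Matrix.IsHermitian.eigenvalues_injective_of_superdiag {n : ℕ}
    {A : Matrix (Fin n) (Fin n) ℝ} (hA : A.IsHermitian)
    (hzero : ∀ i j : Fin n, (i : ℕ) + 1 < j → A i j = 0)
    (hne : ∀ i j : Fin n, (i : ℕ) + 1 = j → A i j ≠ 0) :
    Function.Injective hA.eigenvalues := by
  intro i j hij
  by_contra hne'
  have hn : 0 < n := i.pos
  set b := hA.eigenvectorBasis with hb
  have hi := hA.mulVec_eigenvectorBasis i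
  have hj := hA.mulVec_eigenvectorBasis j
  rw [← hij] at hj
  have hw : A.mulVec ((b j).ofLp ⟨0, hn⟩ • (b i).ofLp - (b i).ofLp ⟨0, hn⟩ • (b j).ofLp) =
      hA.eigenvalues i •
        ((b j).ofLp ⟨0, hn⟩ • (b i).ofLp - (b i).ofLp ⟨0, hn⟩ • (b j).ofLp) := by
    rw [Matrix.mulVec_sub, Matrix.mulVec_smul, Matrix.mulVec_smul, hi, hj, smul_sub,
      smul_comm, smul_comm (hA.eigenvalues i) ((b i).ofLp ⟨0, hn⟩)]
  have hw0 := Matrix.eq_zero_of_superdiag_of_zero A hzero hne hw (by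
    intro l hl
    obtain rfl : l = ⟨0, hn⟩ := Fin.ext hl
    simp [mul_comm])
  have hcomb : (b j).ofLp ⟨0, hn⟩ • b i = (b i).ofLp ⟨0, hn⟩ • b j := by
    ext l
    have := congrFun hw0 l
    simpa [sub_eq_zero] using this
  have hbj : (b j).ofLp ⟨0, hn⟩ = 0 := by
    have h := congrArg (fun x => inner ℝ (b i) x) hcomb
    simpa [inner_smul_right, b.inner_eq_one, b.inner_eq_zero hne'] using h
  have hz := Matrix.eq_zero_of_superdiag_of_zero A hzero hne hj (by
    intro l hl
    obtain rfl : l = ⟨0, hn⟩ := Fin.ext hl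
    exact hbj)
  have hnorm := b.orthonormal.ne_zero j
  exact hnorm (by ext l; exact congrFun hz l)

theorem mul_sinh_mul_pos {k h : ℝ} (hk : k ≠ 0) (hh : 0 < h) : 0 < Real.sinh (k * h) * k := by
  rcases lt_or_gt_of_ne hk with hk | hk
  · exact mul_pos_of_neg_of_neg (Real.sinh_neg_iff.mpr (mul_neg_of_neg_of_pos hk hh)) hk
  · exact mul_pos (Real.sinh_pos_iff.mpr (mul_pos hk hh)) hk

theorem csch_div_pos {k h : ℝ} (hk : k ≠ 0) (hh : 0 < h) : 0 < csch (k * h) / k := by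
  rw [csch, div_div]
  exact one_div_pos.mpr (mul_sinh_mul_pos hk hh)

theorem csch_div_lt_coth_div {k h : ℝ} (hk : k ≠ 0) (hh : 0 < h) :
    csch (k * h) / k < coth (k * h) / k := by
  rw [csch, coth, div_div, div_div]
  have := mul_sinh_mul_pos hk hh
  gcongr
  exact Real.one_lt_cosh.mpr (mul_ne_zero hk hh.ne')

theorem Amat_isHermitian (n : ℕ) (Δh : ℕ → ℝ) (k : ℝ) : (Amat n Δh k).IsHermitian := by
  ext i j
  simp only [Matrix.conjTranspose_apply, star_trivial, Amat]
  split_ifs <;> first | rfl | omega | simp_all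

theorem Amat_eq_zero_of_lt (n : ℕ) (Δh : ℕ → ℝ) (k : ℝ) (i j : Fin n)
    (h : (i : ℕ) + 1 < j) : Amat n Δh k i j = 0 := by
  rw [Amat, if_neg (by omega), if_neg (by omega), if_neg (by omega)]

theorem Amat_superdiag_ne_zero (n : ℕ) (Δh : ℕ → ℝ) (hΔh : ∀ i ≤ n, 0 < Δh i) {k : ℝ}
    (hk : k ≠ 0) (i j : Fin n) (h : (i : ℕ) + 1 = j) : Amat n Δh k i j ≠ 0 := by
  rw [Amat, if_neg (by omega), if_pos h]
  exact neg_ne_zero.mpr (csch_div_pos hk (hΔh _ (by omega))).ne'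

theorem sum_norm_Amat_offDiag_lt (n : ℕ) (Δh : ℕ → ℝ) (hΔh : ∀ i ≤ n, 0 < Δh i) {k : ℝ}
    (hk : k ≠ 0) (i : Fin n) :
    ∑ j ∈ Finset.univ.erase i, ‖Amat n Δh k i j‖ < Amat n Δh k i i := by
  have hp0 := csch_div_pos hk (hΔh i (by omega))
  have hp1 := csch_div_pos hk (hΔh (i + 1) (by omega))
  have hl0 := csch_div_lt_coth_div hk (hΔh i (by omega))
  have hl1 := csch_div_lt_coth_div hk (hΔh (i + 1) (by omega))
  set s₀ := csch (k * Δh i) / k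
  set s₁ := csch (k * Δh (i + 1)) / k
  have hdiag : Amat n Δh k i i
      = 1 + coth (k * Δh i) / k + coth (k * Δh (i + 1)) / k := by
    rw [Amat, if_pos rfl]
    field_simp
  have hterm : ∀ j ∈ Finset.univ.erase i, ‖Amat n Δh k i j‖ ≤
      (if (i : ℕ) + 1 = j then s₁ else 0) + (if (j : ℕ) + 1 = i then s₀ else 0) := by
    intro j hj
    have hji : (i : ℕ) ≠ j := fun h => (Finset.mem_erase.mp hj).1 (Fin.ext h.symm)
    rw [Amat, if_neg hji]
    by_cases h1 : (i : ℕ) + 1 = j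
    · rw [if_pos h1, if_pos h1, if_neg (by omega), norm_neg, Real.norm_of_nonneg hp1.le, add_zero]
    · by_cases h2 : (j : ℕ) + 1 = i
      · rw [if_neg h1, if_neg h1, if_pos h2, if_pos h2, norm_neg, h2,
          Real.norm_of_nonneg hp0.le, zero_add]
      · simp [h1, h2]
  have hsub : ∑ j ∈ Finset.univ.erase i, ‖Amat n Δh k i j‖ ≤
      ∑ j : Fin n,
        ((if (i : ℕ) + 1 = j then s₁ else 0) + (if (j : ℕ) + 1 = i then s₀ else 0)) :=
    (Finset.sum_le_sum hterm).trans
      (Finset.sum_le_sum_of_subset_of_nonneg (Finset.erase_subset _ _) (by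
        intros; positivity))
  have hs1 : ∑ j : Fin n, (if (i : ℕ) + 1 = j then s₁ else 0) ≤ s₁ := by
    rw [Fin.sum_univ_eq_sum_range (fun j => if (i : ℕ) + 1 = j then s₁ else 0),
      Finset.sum_ite_eq]
    split_ifs
    exacts [le_rfl, hp1.le]
  have hs0 : ∑ j : Fin n, (if (j : ℕ) + 1 = i then s₀ else 0) ≤ s₀ := by
    rw [Fin.sum_univ_eq_sum_range (fun j => if j + 1 = (i : ℕ) then s₀ else 0)]
    rcases Nat.eq_zero_or_eq_succ_pred (i : ℕ) with h | h
    · simp [h, hp0.le]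
    · rw [h]
      simp only [Nat.succ_eq_add_one, Nat.add_right_cancel_iff, Finset.sum_ite_eq']
      split_ifs
      exacts [le_rfl, hp0.le]
  rw [Finset.sum_add_distrib] at hsub
  linarith

theorem Amat_eigenvalues_pos (n : ℕ) (Δh : ℕ → ℝ) (hΔh : ∀ i ≤ n, 0 < Δh i) {k : ℝ}
    (hk : k ≠ 0) (i : Fin n) : 0 < (Amat_isHermitian n Δh k).eigenvalues i := by
  set hA := Amat_isHermitian n Δh k
  have hev : Module.End.HasEigenvalue (Matrix.toLin' (Amat n Δh k)) (hA.eigenvalues i) := by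
    refine Module.End.hasEigenvalue_of_hasEigenvector (x := (hA.eigenvectorBasis i).ofLp)
      (Module.End.hasEigenvector_iff.mpr ⟨Module.End.mem_eigenspace_iff.mpr ?_, ?_⟩)
    · simpa using hA.mulVec_eigenvectorBasis i
    · intro h
      exact hA.eigenvectorBasis.orthonormal.ne_zero i (by ext l; exact congrFun h l)
  obtain ⟨l, hl⟩ := eigenvalue_mem_ball hev
  rw [Metric.mem_closedBall, Real.dist_eq] at hl
  have h1 := sum_norm_Amat_offDiag_lt n Δh hΔh hk l
  have h2 := (abs_le.mp hl).1
  linarith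

theorem Mmat_of_zero_flow (n : ℕ) (Δh U : ℕ → ℝ) (hU : ∀ j ≤ n, U j = 0) (k : ℝ) :
    Mmat n Δh U k = Matrix.fromBlocks 0 1
      ((-(k : ℂ) ^ 4) • ((Amat n Δh k)⁻¹).map (fun x : ℝ => (x : ℂ))) 0 := by
  have hB : Bmat n Δh U k = 0 := by
    ext i j
    simp [Bmat, hU i (by omega), hU (i + 1) (by omega), hU (j + 1) (by omega)]
  have hC : Cmat n Δh U k = 0 := by
    ext i j
    simp [Cmat, hU i (by omega), hU (i + 1) (by omega), hU (j + 1) (by omega)]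
  rw [Mmat, hB, hC]
  congr 1
  · ext i j
    simp
  · ext i j
    simp

/-- `(v, μ v)` is an eigenvector of `M(k)` when `A(k) v = lam v` and `lam μ² = -k⁴`. -/
theorem Mmat_mulVec_elim (n : ℕ) (Δh U : ℕ → ℝ) (hU : ∀ j ≤ n, U j = 0) (k : ℝ)
    (hdet : IsUnit (Amat n Δh k).det) {lam : ℝ} {v : Fin n → ℝ}
    (hv : (Amat n Δh k).mulVec v = lam • v) {μ : ℂ} (hμ : (lam : ℂ) * μ ^ 2 = -(k : ℂ) ^ 4) :
    (Mmat n Δh U k).mulVec (Sum.elim (fun i => (v i : ℂ)) (fun i => μ * v i)) =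
      μ • Sum.elim (fun i => (v i : ℂ)) (fun i => μ * v i) := by
  have hinv : lam • (Amat n Δh k)⁻¹.mulVec v = v := by
    rw [← Matrix.mulVec_smul, ← hv, Matrix.mulVec_mulVec, Matrix.nonsing_inv_mul _ hdet,
      Matrix.one_mulVec]
  have hinvC (i : Fin n) : (lam : ℂ) *
      ((Amat n Δh k)⁻¹.map (fun x : ℝ => (x : ℂ))).mulVec (fun i => (v i : ℂ)) i = v i := by
    have h := congrArg (fun x : ℝ => (x : ℂ)) (congrFun hinv i)
    simpa [Matrix.mulVec, dotProduct] using h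
  rw [Mmat_of_zero_flow n Δh U hU, Matrix.fromBlocks_mulVec]
  funext i
  rcases i with i | i
  · simp [Function.comp_def]
  · have h := hinvC i
    simp only [Function.comp_def, Sum.elim_inl, Sum.elim_inr, Matrix.zero_mulVec, add_zero,
      Matrix.smul_mulVec, Pi.smul_apply, smul_eq_mul]
    rw [← hμ]
    linear_combination μ ^ 2 * h

/-- The square roots `± i k² / √lam` of `-k⁴ / lam`, indexed by two copies of the index type. -/
noncomputable def signedFreq {ι : Type*} (k : ℝ) (lam : ι → ℝ) : ι ⊕ ι → ℝ :=
  Sum.elim (fun i => k ^ 2 / Real.sqrt (lam i)) (fun i => -(k ^ 2 / Real.sqrt (lam i)))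

theorem signedFreq_injective {ι : Type*} {k : ℝ} (hk : k ≠ 0) {lam : ι → ℝ}
    (hpos : ∀ i, 0 < lam i) (hinj : Function.Injective lam) :
    Function.Injective (signedFreq k lam) := by
  have hp (i : ι) : 0 < k ^ 2 / Real.sqrt (lam i) := by
    have := Real.sqrt_pos.mpr (hpos i)
    positivity
  have hq (i j : ι) (h : k ^ 2 / Real.sqrt (lam i) = k ^ 2 / Real.sqrt (lam j)) : i = j := by
    rw [div_eq_mul_inv, div_eq_mul_inv] at h
    have h' := inv_injective (mul_left_cancel₀ (pow_ne_zero 2 hk) h)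
    exact hinj ((Real.sqrt_inj (hpos i).le (hpos j).le).mp h')
  rintro (i | i) (j | j) h <;> simp only [signedFreq, Sum.elim_inl, Sum.elim_inr] at h
  · rw [hq i j h]
  · linarith [hp i, hp j]
  · linarith [hp i, hp j]
  · rw [hq i j (neg_injective h)]

theorem mul_signedFreq_sq {ι : Type*} (k : ℝ) {lam : ι → ℝ} (hpos : ∀ i, 0 < lam i)
    (s : ι ⊕ ι) :
    ((lam (Sum.elim id id s) : ℝ) : ℂ) * ((signedFreq k lam s : ℝ) * Complex.I) ^ 2
      = -(k : ℂ) ^ 4 := by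
  have h : lam (Sum.elim id id s) * signedFreq k lam s ^ 2 = k ^ 4 := by
    rcases s with i | i <;>
    · have h0 := (hpos i).ne'
      simp only [signedFreq, Sum.elim_inl, Sum.elim_inr, id, neg_sq, div_pow,
        Real.sq_sqrt (hpos i).le]
      field_simp
  rw [mul_pow, Complex.I_sq]
  have hC := congrArg (fun x : ℝ => (x : ℂ)) h
  push_cast at hC
  linear_combination -hC

/-- if all mean-flow speeds vanish, then for every real `k ≠ 0`:
`μ` is an eigenvalue of `M(k)` iff some (real) eigenvalue `λ` of `A(k)` satisfies
`λ μ² = −k⁴`; every eigenvalue of `M(k)` is purely imaginary; `M(k)` has exactly `2n`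
distinct eigenvalues; and `M(k)` is diagonalisable. -/
theorem statement12 (n : ℕ) (hn : 1 ≤ n) (Δh U : ℕ → ℝ) (hΔh : ∀ i ≤ n, 0 < Δh i)
    (hU : ∀ j ≤ n, U j = 0) (k : ℝ) (hk : k ≠ 0) :
    (∀ μ : ℂ, μ ∈ (Mmat n Δh U k).charpoly.roots ↔
      ∃ lam : ℝ, lam ∈ (Amat n Δh k).charpoly.roots ∧ (lam : ℂ) * μ ^ 2 = -(k : ℂ) ^ 4) ∧
    (∀ μ ∈ (Mmat n Δh U k).charpoly.roots, μ.re = 0) ∧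
    (Mmat n Δh U k).charpoly.roots.toFinset.card = 2 * n ∧
    ∃ P D : Matrix (Fin n ⊕ Fin n) (Fin n ⊕ Fin n) ℂ,
      IsUnit P.det ∧ D.IsDiag ∧ Mmat n Δh U k = P * D * P⁻¹ := by
  set hA := Amat_isHermitian n Δh k
  have hpos : ∀ i, 0 < hA.eigenvalues i := Amat_eigenvalues_pos n Δh hΔh hk
  have hinj : Function.Injective hA.eigenvalues :=
    hA.eigenvalues_injective_of_superdiag (Amat_eq_zero_of_lt n Δh k)
      (Amat_superdiag_ne_zero n Δh hΔh hk)
  have hdet : IsUnit (Amat n Δh k).det := by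
    rw [hA.det_eq_prod_eigenvalues, isUnit_iff_ne_zero]
    exact Finset.prod_ne_zero_iff.mpr fun i _ => by simpa using (hpos i).ne'
  set d : Fin n ⊕ Fin n → ℂ := fun s => (signedFreq k hA.eigenvalues s : ℝ) * Complex.I with hd
  have hdinj : Function.Injective d := fun s t h =>
    signedFreq_injective hk hpos hinj
      (Complex.ofReal_injective (mul_right_cancel₀ Complex.I_ne_zero h))
  have hdsq (s : Fin n ⊕ Fin n) :
      ((hA.eigenvalues (Sum.elim id id s) : ℝ) : ℂ) * d s ^ 2 = -(k : ℂ) ^ 4 :=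
    mul_signedFreq_sq k hpos s
  let b : Fin n ⊕ Fin n → Fin n → ℝ := fun s => (hA.eigenvectorBasis (Sum.elim id id s)).ofLp
  obtain ⟨P, hP, hM⟩ := Matrix.exists_diagonalization_of_eigenvectors (Mmat n Δh U k) d hdinj
    (fun s => Sum.elim (fun i => (b s i : ℂ)) (fun i => d s * b s i))
    (by
      intro s h
      refine hA.eigenvectorBasis.orthonormal.ne_zero (Sum.elim id id s) ?_
      ext l
      simpa [b] using congrFun h (Sum.inl l))
    (fun s => Mmat_mulVec_elim n Δh U hU k hdet
      (hA.mulVec_eigenvectorBasis (Sum.elim id id s)) (hdsq s))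
  have hroots := Matrix.roots_charpoly_of_diagonalization hP hM
  have hmem (μ : ℂ) : μ ∈ (Mmat n Δh U k).charpoly.roots ↔ ∃ s, d s = μ := by
    rw [hroots]
    simp
  have hmemA (lam : ℝ) : lam ∈ (Amat n Δh k).charpoly.roots ↔ ∃ i, hA.eigenvalues i = lam := by
    rw [hA.roots_charpoly_eq_eigenvalues]
    simp
  refine ⟨fun μ => ?_, fun μ hμ => ?_, ?_, P, Matrix.diagonal d, hP, Matrix.isDiag_diagonal d, hM⟩
  · rw [hmem]
    constructor
    · rintro ⟨s, rfl⟩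
      exact ⟨_, (hmemA _).mpr ⟨_, rfl⟩, hdsq s⟩
    · rintro ⟨lam, hlam, hμ⟩
      obtain ⟨i, rfl⟩ := (hmemA _).mp hlam
      have hne : ((hA.eigenvalues i : ℝ) : ℂ) ≠ 0 := Complex.ofReal_ne_zero.mpr (hpos i).ne'
      have hsq : μ ^ 2 = d (Sum.inl i) ^ 2 :=
        mul_left_cancel₀ hne (hμ.trans (hdsq (Sum.inl i)).symm)
      rcases sq_eq_sq_iff_eq_or_eq_neg.mp hsq with h | h
      · exact ⟨Sum.inl i, h.symm⟩
      · exact ⟨Sum.inr i, by rw [h]; simp [hd, signedFreq]⟩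
  · obtain ⟨s, rfl⟩ := (hmem μ).mp hμ
    simp [hd]
  · rw [hroots, Multiset.toFinset_card_of_nodup
      ((Multiset.nodup_map_iff_of_injective hdinj).mpr Finset.univ.nodup)]
    simp [two_mul]
end
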